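/- For every summary graph H and disjoint subsets M and C of its node set, the graph α_SG(H;M,C) generated by the SG-generating algorithm is a summary graph. -/

import Mathlib

/-!
Stable mixed graphs: mixed graphs with arrows, arcs and lines; ribbonless,
summary and ancestral graphs; the generating maps α_RG, α_SG, α_AG;
m-connecting paths, m-separation and induced independence models.
-/

namespace StableMixedGraphs

/-- A mixed graph on node type `V`: a node set together with three edge
relations: arrows (`arrow i j` means an arrow from `i` to `j`), arcs
(two-headed, symmetric) and lines (undirected, symmetric). -/
structure MixedGraph (V : Type) where
  nodes : Set V
  arrow : V → V → Prop
  arc : V → V → Prop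
  line : V → V → Prop

namespace MixedGraph

variable {V W : Type}

/-- Wellformedness: arcs and lines are symmetric relations and all edges join
nodes of the graph. -/
def Wf (G : MixedGraph V) : Prop :=
  (∀ i j, G.arc i j → G.arc j i) ∧
  (∀ i j, G.line i j → G.line j i) ∧
  (∀ i j, G.arrow i j ∨ G.arc i j ∨ G.line i j → i ∈ G.nodes ∧ j ∈ G.nodes)

/-- No loops of any of the three kinds. -/
def Loopless (G : MixedGraph V) : Prop :=
  ∀ i, ¬ G.arrow i i ∧ ¬ G.arc i i ∧ ¬ G.line i i

/-- A loopless mixed graph with a finite node set. -/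
def IsLMG (G : MixedGraph V) : Prop := G.Wf ∧ G.Loopless ∧ G.nodes.Finite

/-- `G.anc i j` : `i` is an ancestor of `j`, i.e. there is a
direction-preserving path from `i` to `j`. -/
def anc (G : MixedGraph V) (i j : V) : Prop := Relation.TransGen G.arrow i j

/-- The set of ancestors of nodes of `C`. -/
def anSet (G : MixedGraph V) (C : Set V) : Set V := {a | ∃ c ∈ C, G.anc a c}

/-- `i` lies on a direction-preserving cycle. -/
def OnDPCycle (G : MixedGraph V) (i : V) : Prop := G.anc i i

/-- `i` is an endpoint of a line. -/
def LineEndpoint (G : MixedGraph V) (i : V) : Prop := ∃ j, G.line i j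

/-- Condition (2) of a ribbon: `i` or a descendant of `i` is an endpoint of a
line or lies on a direction-preserving cycle. -/
def RibbonTail (G : MixedGraph V) (i : V) : Prop :=
  ∃ d, (d = i ∨ G.anc i d) ∧ (G.LineEndpoint d ∨ G.OnDPCycle d)

/-- `G` contains a ribbon: a collider V-configuration `⟨h,i,j⟩` with no
endpoint-identical edge between `h` and `j`, whose inner node `i` (or a
descendant of it) is an endpoint of a line or on a direction-preserving
cycle. -/
def HasRibbon (G : MixedGraph V) : Prop :=
  ∃ h i j, h ≠ i ∧ i ≠ j ∧ h ≠ j ∧ G.RibbonTail i ∧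
    ((G.arc h i ∧ G.arc i j ∧ ¬ G.arc h j) ∨
     (G.arrow h i ∧ G.arrow j i ∧ ¬ G.line h j) ∨
     (G.arrow h i ∧ G.arc i j ∧ ¬ G.arrow h j))

/-- A ribbonless graph: a loopless mixed graph with no ribbon. -/
def IsRG (G : MixedGraph V) : Prop := G.IsLMG ∧ ¬ G.HasRibbon

/-- A directed acyclic graph: only arrows, no direction-preserving cycle. -/
def IsDAG (G : MixedGraph V) : Prop :=
  G.IsLMG ∧ (∀ i j, ¬ G.arc i j) ∧ (∀ i j, ¬ G.line i j) ∧ ∀ i, ¬ G.anc i i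

/-- A summary graph: a loopless mixed graph with no arrowhead pointing to an
endpoint of a line and no direction-preserving cycle. -/
def IsSG (G : MixedGraph V) : Prop :=
  G.IsLMG ∧ (∀ i, G.LineEndpoint i → ∀ k, ¬ G.arrow k i ∧ ¬ G.arc k i) ∧
    ∀ i, ¬ G.anc i i

/-- A simple mixed graph: no loops and no multiple edges. -/
def Simple (G : MixedGraph V) : Prop :=
  G.Loopless ∧ ∀ i j,
    (G.arrow i j → ¬ G.arrow j i ∧ ¬ G.arc i j ∧ ¬ G.line i j) ∧
    (G.arc i j → ¬ G.line i j)

/-- An ancestral graph: a simple mixed graph such that no node is an ancestor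
of one of its parents or spouses, and a node with a neighbour has neither
parents nor spouses. -/
def IsAG (G : MixedGraph V) : Prop :=
  G.Wf ∧ G.Simple ∧ G.nodes.Finite ∧
  (∀ i j, G.arrow j i ∨ G.arc j i → ¬ G.anc i j) ∧
  (∀ i, G.LineEndpoint i → ∀ k, ¬ G.arrow k i ∧ ¬ G.arc k i)

/-- An undirected graph: only lines. -/
def IsUG (G : MixedGraph V) : Prop :=
  G.IsLMG ∧ (∀ i j, ¬ G.arrow i j) ∧ ∀ i j, ¬ G.arc i j

/-- A bidirected graph: only arcs. -/
def IsBG (G : MixedGraph V) : Prop :=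
  G.IsLMG ∧ (∀ i j, ¬ G.arrow i j) ∧ ∀ i j, ¬ G.line i j

/-- Image of a mixed graph under a map of node types. -/
def map (f : V → W) (G : MixedGraph V) : MixedGraph W where
  nodes := f '' G.nodes
  arrow a b := ∃ i j, G.arrow i j ∧ f i = a ∧ f j = b
  arc a b := ∃ i j, G.arc i j ∧ f i = a ∧ f j = b
  line a b := ∃ i j, G.line i j ∧ f i = a ∧ f j = b

end MixedGraph

/-! ### The closure generating new edges (Table 1 of the RG-generating
algorithm), for given marginalisation set `M` and collider set
`S = C ∪ an(C)`.  For every V-configuration whose inner node is a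
non-collider in `M` (rows 1–7) or a collider in `S` (rows 8–10) the
endpoint-identical edge between the endpoints is generated, repeatedly
until closure. -/

mutual
  /-- Generated arrows (`GenArrow H M S j i`: arrow from `j` to `i`). -/
  inductive GenArrow {V : Type} (H : MixedGraph V) (M S : Set V) : V → V → Prop
    | base {i j : V} : H.arrow i j → GenArrow H M S i j
    | row1 {i j m : V} : m ∈ M → j ≠ i →
        GenArrow H M S j m → GenArrow H M S m i → GenArrow H M S j i
    | row2 {i j m : V} : m ∈ M → j ≠ i →
        GenLine H M S j m → GenArrow H M S m i → GenArrow H M S j i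
    | row3 {i j m : V} : m ∈ M → j ≠ i →
        GenLine H M S j m → GenArc H M S m i → GenArrow H M S j i
    | row8 {i j s : V} : s ∈ S → j ≠ i →
        GenArrow H M S j s → GenArc H M S s i → GenArrow H M S j i

  /-- Generated arcs. -/
  inductive GenArc {V : Type} (H : MixedGraph V) (M S : Set V) : V → V → Prop
    | base {i j : V} : H.arc i j → GenArc H M S i j
    | symm {i j : V} : GenArc H M S i j → GenArc H M S j i
    | row4 {i j m : V} : m ∈ M → i ≠ j →
        GenArrow H M S m i → GenArrow H M S m j → GenArc H M S i j
    | row5 {i j m : V} : m ∈ M → i ≠ j →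
        GenArrow H M S m i → GenArc H M S m j → GenArc H M S i j
    | row9 {i j s : V} : s ∈ S → i ≠ j →
        GenArc H M S i s → GenArc H M S s j → GenArc H M S i j

  /-- Generated lines. -/
  inductive GenLine {V : Type} (H : MixedGraph V) (M S : Set V) : V → V → Prop
    | base {i j : V} : H.line i j → GenLine H M S i j
    | symm {i j : V} : GenLine H M S i j → GenLine H M S j i
    | row6 {i j m : V} : m ∈ M → i ≠ j →
        GenLine H M S i m → GenArrow H M S j m → GenLine H M S i j
    | row7 {i j m : V} : m ∈ M → i ≠ j →
        GenLine H M S i m → GenLine H M S m j → GenLine H M S i j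
    | row10 {i j s : V} : s ∈ S → i ≠ j →
        GenArrow H M S i s → GenArrow H M S j s → GenLine H M S i j
end

variable {V : Type}

/-- The RG-generating map `α_RG(H;M,C)`: generate all edges of the closure
and delete the nodes of `M ∪ C`. -/
def alphaRG (H : MixedGraph V) (M C : Set V) : MixedGraph V where
  nodes := H.nodes \ (M ∪ C)
  arrow i j := i ∈ H.nodes \ (M ∪ C) ∧ j ∈ H.nodes \ (M ∪ C) ∧
    GenArrow H M (C ∪ H.anSet C) i j
  arc i j := i ∈ H.nodes \ (M ∪ C) ∧ j ∈ H.nodes \ (M ∪ C) ∧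
    GenArc H M (C ∪ H.anSet C) i j
  line i j := i ∈ H.nodes \ (M ∪ C) ∧ j ∈ H.nodes \ (M ∪ C) ∧
    GenLine H M (C ∪ H.anSet C) i j

/-- The arrowhead-removal operation `α_RG.SG(K;A)`: every arrowhead pointing
at a node of `A` is removed (an arrow at such a node becomes a line, an arc
becomes an arrow, an arc with both endpoints in `A` becomes a line),
repeatedly until closure. -/
def deheadAt (K : MixedGraph V) (A : Set V) : MixedGraph V where
  nodes := K.nodes
  arrow j i := i ∉ A ∧ (K.arrow j i ∨ (K.arc j i ∧ j ∈ A))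
  arc i j := K.arc i j ∧ i ∉ A ∧ j ∉ A
  line i j := K.line i j ∨ (K.arrow j i ∧ i ∈ A) ∨ (K.arrow i j ∧ j ∈ A) ∨
    (K.arc i j ∧ i ∈ A ∧ j ∈ A)

/-- The SG-generating map `α_SG(H;M,C)`: mark the nodes of `an(C)`, apply the
RG-generating construction, then remove all arrowheads pointing at marked
nodes. -/
def alphaSG (H : MixedGraph V) (M C : Set V) : MixedGraph V :=
  deheadAt (alphaRG H M C) (H.anSet C)

/-! ### Step 2 of the AG-generating algorithm: for every V-configuration
`j → k ↔ i` or `j ↔ k ↔ i` with `k ∈ an(i)` (in the current graph) generate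
an arrow from `j` to `i`, respectively an arc between `j` and `i`, until
closure. -/

mutual
  inductive AG2Arrow {V : Type} (K : MixedGraph V) : V → V → Prop
    | base {i j : V} : K.arrow j i → AG2Arrow K j i
    | gen {i j k : V} : j ≠ i → AG2Arrow K j k → AG2Arc K k i →
        AG2Anc K k i → AG2Arrow K j i

  inductive AG2Arc {V : Type} (K : MixedGraph V) : V → V → Prop
    | base {i j : V} : K.arc i j → AG2Arc K i j
    | symm {i j : V} : AG2Arc K i j → AG2Arc K j i
    | gen {i j k : V} : j ≠ i → AG2Arc K j k → AG2Arc K k i →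
        AG2Anc K k i → AG2Arc K j i

  /-- The ancestor relation of the graph being generated in step 2. -/
  inductive AG2Anc {V : Type} (K : MixedGraph V) : V → V → Prop
    | single {i j : V} : AG2Arrow K i j → AG2Anc K i j
    | tail {i k j : V} : AG2Arrow K i k → AG2Anc K k j → AG2Anc K i j
end

/-- The graph after step 2 of the AG-generating algorithm. -/
def ag2 (K : MixedGraph V) : MixedGraph V where
  nodes := K.nodes
  arrow := AG2Arrow K
  arc := AG2Arc K
  line := K.line

/-! ### Step 3 of the AG-generating algorithm: repeatedly replace every arc
between `j` and `i` with `j ∈ an(i)` (in the current graph) by an arrow from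
`j` to `i`. -/

mutual
  inductive AG3Arrow {V : Type} (K : MixedGraph V) : V → V → Prop
    | base {i j : V} : K.arrow j i → AG3Arrow K j i
    | conv {i j : V} : K.arc j i → AG3Anc K j i → AG3Arrow K j i

  /-- The ancestor relation of the graph being generated in step 3. -/
  inductive AG3Anc {V : Type} (K : MixedGraph V) : V → V → Prop
    | single {i j : V} : AG3Arrow K i j → AG3Anc K i j
    | tail {i k j : V} : AG3Arrow K i k → AG3Anc K k j → AG3Anc K i j
end

/-- Steps 2 and 3 of the AG-generating algorithm, applied to a summary
graph: `α_SG.AG`. -/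
def alphaSGAG (K : MixedGraph V) : MixedGraph V :=
  let K2 := ag2 K
  { nodes := K.nodes
    arrow := AG3Arrow K2
    arc := fun i j => K2.arc i j ∧ ¬ AG3Anc K2 i j ∧ ¬ AG3Anc K2 j i
    line := K.line }

/-- The AG-generating map `α_AG(H;M,C)`. -/
def alphaAG (H : MixedGraph V) (M C : Set V) : MixedGraph V :=
  alphaSGAG (alphaSG H M C)

/-! ### Paths, m-connection and m-separation. -/

/-- A step of a walk: it goes from `src` to `tgt` along an edge which has an
arrowhead at `src` iff `hs = true` and an arrowhead at `tgt` iff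
`ht = true` (so `hs = ht = false` is a line, `hs = ht = true` an arc, and
exactly one head an arrow in the corresponding direction). -/
structure Step (V : Type) where
  src : V
  tgt : V
  hs : Bool
  ht : Bool

/-- The edge of a step is present in `G`. -/
def Step.valid (G : MixedGraph V) (s : Step V) : Prop :=
  match s.hs, s.ht with
  | false, false => G.line s.src s.tgt
  | false, true  => G.arrow s.src s.tgt
  | true,  false => G.arrow s.tgt s.src
  | true,  true  => G.arc s.src s.tgt

/-- `w` is a path from `i` to `j` in `G`: a nonempty chained list of valid
steps with no repeated nodes. -/
def IsPath (G : MixedGraph V) (i j : V) (w : List (Step V)) : Prop :=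
  w ≠ [] ∧ (∀ s ∈ w, s.valid G) ∧ List.Chain' (fun a b => a.tgt = b.src) w ∧
    w.head?.map Step.src = some i ∧ w.getLast?.map Step.tgt = some j ∧
    (i :: w.map Step.tgt).Nodup

/-- The path `w` is m-connecting given `M` and `C`: every inner collider node
is in `C ∪ an(C)` and every inner non-collider node is in `M`. -/
def MConnPath (G : MixedGraph V) (M C : Set V) (w : List (Step V)) : Prop :=
  List.Chain'
    (fun a b =>
      (a.ht = true ∧ b.hs = true → a.tgt ∈ C ∪ G.anSet C) ∧
      (¬ (a.ht = true ∧ b.hs = true) → a.tgt ∈ M)) w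

/-- `A ⊥_m B | C` in `G` : there is no m-connecting path between `A` and `B`
given `C` (with `M` the remaining nodes). -/
def MSep (G : MixedGraph V) (A B C : Set V) : Prop :=
  ∀ i ∈ A, ∀ j ∈ B, ∀ w : List (Step V),
    IsPath G i j w → ¬ MConnPath G (G.nodes \ (A ∪ B ∪ C)) C w

/-- The independence model induced by `G` via m-separation: the set of
triples `⟨A,B|C⟩` of pairwise disjoint subsets of the nodes with
`A ⊥_m B | C`. -/
def Jm (G : MixedGraph V) : Set (Set V × Set V × Set V) :=
  {t | t.1 ⊆ G.nodes ∧ t.2.1 ⊆ G.nodes ∧ t.2.2 ⊆ G.nodes ∧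
    Disjoint t.1 t.2.1 ∧ Disjoint t.1 t.2.2 ∧ Disjoint t.2.1 t.2.2 ∧
    MSep G t.1 t.2.1 t.2.2}

/-- The independence model after marginalisation over `M` and conditioning on
`C` : `α(J;M,C)`. -/
def alphaIM (J : Set (Set V × Set V × Set V)) (M C : Set V) :
    Set (Set V × Set V × Set V) :=
  {t | (t.1, t.2.1, t.2.2 ∪ C) ∈ J ∧ (t.1 ∪ t.2.1 ∪ t.2.2) ∩ (M ∪ C) = ∅}

/-- A node which is an ancestor of `C` or an endpoint of a line. -/
def AnteriorTo (H : MixedGraph V) (C : Set V) (i : V) : Prop :=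
  i ∈ H.anSet C ∨ H.LineEndpoint i

theorem mem_anSet_of_anc {H : MixedGraph V} {C : Set V} {i j : V} (h : H.anc i j)
    (hj : j ∈ C ∪ H.anSet C) : i ∈ H.anSet C := by
  rcases hj with hj | ⟨c, hc, hjc⟩
  · exact ⟨j, hj, h⟩
  · exact ⟨c, hc, Relation.TransGen.trans h hjc⟩

theorem anteriorTo_of_mem {H : MixedGraph V} {C : Set V} {i j : V}
    (h : H.anc i j ∨ AnteriorTo H C i) (hj : j ∈ C ∪ H.anSet C) : AnteriorTo H C i :=
  h.elim (fun h => .inl (mem_anSet_of_anc h hj)) id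

mutual

/-- In a summary graph, a generated arrow does not point to an endpoint of a line, and its
source is an ancestor of its target or anterior to `C`. -/
theorem GenArrow.invariant {H : MixedGraph V} {M C : Set V}
    (hH : H.IsSG) {j i : V} :
    GenArrow H M (C ∪ H.anSet C) j i →
      ¬ H.LineEndpoint i ∧ (H.anc j i ∨ AnteriorTo H C j)
  | .base h => ⟨fun hi => (hH.2.1 _ hi _).1 h, .inl (.single h)⟩
  | .row1 _ _ h₁ h₂ => by
    have a := GenArrow.invariant hH h₁
    have b := GenArrow.invariant hH h₂
    refine ⟨b.1, ?_⟩
    rcases b.2 with b | b | b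
    · exact a.2.imp_left fun a => Relation.TransGen.trans a b
    · exact .inr (anteriorTo_of_mem a.2 (.inr b))
    · exact absurd b a.1
  | .row2 _ _ h₁ h₂ => ⟨(GenArrow.invariant hH h₂).1, .inr (GenLine.invariant hH h₁).1⟩
  | .row3 _ _ h₁ h₂ => ⟨(GenArc.invariant hH h₂).2, .inr (GenLine.invariant hH h₁).1⟩
  | .row8 hs _ h₁ h₂ =>
    ⟨(GenArc.invariant hH h₂).2, .inr (anteriorTo_of_mem (GenArrow.invariant hH h₁).2 hs)⟩

/-- In a summary graph, a generated arc does not point to an endpoint of a line. -/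
theorem GenArc.invariant {H : MixedGraph V} {M C : Set V}
    (hH : H.IsSG) {i j : V} :
    GenArc H M (C ∪ H.anSet C) i j → ¬ H.LineEndpoint i ∧ ¬ H.LineEndpoint j
  | .base h =>
    ⟨fun hi => (hH.2.1 _ hi _).2 (hH.1.1.1 _ _ h), fun hj => (hH.2.1 _ hj _).2 h⟩
  | .symm h => (GenArc.invariant hH h).symm
  | .row4 _ _ h₁ h₂ => ⟨(GenArrow.invariant hH h₁).1, (GenArrow.invariant hH h₂).1⟩
  | .row5 _ _ h₁ h₂ => ⟨(GenArrow.invariant hH h₁).1, (GenArc.invariant hH h₂).2⟩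
  | .row9 _ _ h₁ h₂ => ⟨(GenArc.invariant hH h₁).1, (GenArc.invariant hH h₂).2⟩

/-- In a summary graph, both endpoints of a generated line are anterior to `C`. -/
theorem GenLine.invariant {H : MixedGraph V} {M C : Set V}
    (hH : H.IsSG) {i j : V} :
    GenLine H M (C ∪ H.anSet C) i j → AnteriorTo H C i ∧ AnteriorTo H C j
  | .base h => ⟨.inr ⟨_, h⟩, .inr ⟨_, hH.1.1.2.1 _ _ h⟩⟩
  | .symm h => (GenLine.invariant hH h).symm
  | .row6 _ _ h₁ h₂ => by
    have a := GenLine.invariant hH h₁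
    have b := GenArrow.invariant hH h₂
    exact ⟨a.1, anteriorTo_of_mem b.2 (.inr (a.2.resolve_right b.1))⟩
  | .row7 _ _ h₁ h₂ => ⟨(GenLine.invariant hH h₁).1, (GenLine.invariant hH h₂).2⟩
  | .row10 hs _ h₁ h₂ =>
    ⟨anteriorTo_of_mem (GenArrow.invariant hH h₁).2 hs,
      anteriorTo_of_mem (GenArrow.invariant hH h₂).2 hs⟩

end

theorem GenArrow.ne {H : MixedGraph V} {M S : Set V} (hH : H.Loopless) {i j : V}
    (h : GenArrow H M S i j) : i ≠ j := by
  cases h with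
  | base h => rintro rfl; exact (hH _).1 h
  | _ => assumption

theorem GenArc.ne {H : MixedGraph V} {M S : Set V} (hH : H.Loopless) {i j : V} :
    GenArc H M S i j → i ≠ j
  | .base h => by rintro rfl; exact (hH _).2.1 h
  | .symm h => (GenArc.ne hH h).symm
  | .row4 _ h _ _ | .row5 _ h _ _ | .row9 _ h _ _ => h

theorem GenLine.ne {H : MixedGraph V} {M S : Set V} (hH : H.Loopless) {i j : V} :
    GenLine H M S i j → i ≠ j
  | .base h => by rintro rfl; exact (hH _).2.2 h
  | .symm h => (GenLine.ne hH h).symm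
  | .row6 _ h _ _ | .row7 _ h _ _ | .row10 _ h _ _ => h

theorem alphaRG_isLMG {H : MixedGraph V} (M C : Set V) (hH : H.IsLMG) :
    (alphaRG H M C).IsLMG := by
  refine ⟨⟨fun i j h => ⟨h.2.1, h.1, h.2.2.symm⟩, fun i j h => ⟨h.2.1, h.1, h.2.2.symm⟩, ?_⟩,
    fun i => ⟨fun h => h.2.2.ne hH.2.1 rfl, fun h => h.2.2.ne hH.2.1 rfl,
      fun h => h.2.2.ne hH.2.1 rfl⟩, hH.2.2.subset Set.sdiff_subset⟩
  rintro i j (h | h | h) <;> exact ⟨h.1, h.2.1⟩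

theorem deheadAt_isLMG {K : MixedGraph V} (A : Set V) (hK : K.IsLMG) :
    (deheadAt K A).IsLMG := by
  obtain ⟨⟨harc, hline, hnodes⟩, hloop, hfin⟩ := hK
  refine ⟨⟨fun i j h => ⟨harc _ _ h.1, h.2.2, h.2.1⟩, ?_, ?_⟩, ?_, hfin⟩
  · rintro i j (h | h | h | h)
    · exact .inl (hline _ _ h)
    · exact .inr (.inr (.inl h))
    · exact .inr (.inl h)
    · exact .inr (.inr (.inr ⟨harc _ _ h.1, h.2.2, h.2.1⟩))
  · intro i j h
    have hi := hnodes i j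
    have hj := hnodes j i
    change i ∈ K.nodes ∧ j ∈ K.nodes
    simp only [deheadAt] at h
    tauto
  · intro i
    have := hloop i
    simp only [deheadAt]
    tauto

/-- (Proposition 3) For every summary graph `H` and disjoint
subsets `M` and `C` of its node set, the generated graph `α_SG(H;M,C)` is a
summary graph. -/
theorem stmt_8 {V : Type} (H : MixedGraph V) (M C : Set V)
    (hH : H.IsSG) (hM : M ⊆ H.nodes) (hC : C ⊆ H.nodes) (hMC : Disjoint M C) :
    (alphaSG H M C).IsSG := by
  have hline : ∀ i, (alphaSG H M C).LineEndpoint i → AnteriorTo H C i := by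
    rintro i ⟨j, h | ⟨_, hi⟩ | ⟨h, hj⟩ | ⟨_, hi, _⟩⟩
    · exact (h.2.2.invariant hH).1
    · exact .inl hi
    · exact anteriorTo_of_mem (h.2.2.invariant hH).2 (.inr hj)
    · exact .inl hi
  have harrow : ∀ k i, (alphaSG H M C).arrow k i → ¬ AnteriorTo H C i := by
    rintro k i ⟨hi, h | ⟨h, _⟩⟩ (hi' | hi')
    · exact hi hi'
    · exact (h.2.2.invariant hH).1 hi'
    · exact hi hi'
    · exact (h.2.2.invariant hH).2 hi'
  have hanc : ∀ i j, (alphaSG H M C).anc i j →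
      ¬ AnteriorTo H C j ∧ (¬ AnteriorTo H C i → H.anc i j) := by
    have step : ∀ k i, (alphaSG H M C).arrow k i → ¬ AnteriorTo H C k → H.anc k i := by
      rintro k i ⟨_, h | ⟨_, hk'⟩⟩ hk
      · exact (h.2.2.invariant hH).2.resolve_right hk
      · exact absurd (.inl hk') hk
    intro i j h
    induction h with
    | single h => exact ⟨harrow _ _ h, step _ _ h⟩
    | tail _ h ih =>
      exact ⟨harrow _ _ h, fun hi => Relation.TransGen.trans (ih.2 hi) (step _ _ h ih.1)⟩
  refine ⟨deheadAt_isLMG _ (alphaRG_isLMG M C hH.1), fun i hi k => ⟨fun h => ?_, fun h => ?_⟩,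
    fun i h => hH.2.2 i ((hanc i i h).2 (hanc i i h).1)⟩
  · exact harrow k i h (hline i hi)
  · exact (hline i hi).elim h.2.2 (h.1.2.2.invariant hH).2

end StableMixedGraphs
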